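/- Let n ≥ 4. Then: (a) every arithmetical structure (d, r) on the bident D_n satisfies |K(D_n; d, r)| ≤ 2n − 5, and there is exactly one arithmetical structure on D_n whose critical group has order 2n − 5; (b) the maximal even order of a critical group of an arithmetical structure on D_n equals 6k − 4 if n = 4k or n = 4k + 1, and equals 6k − 2 if n = 4k + 2 or n = 4k + 3, for a positive integer k. -/

import Mathlib

/-- `IsArith n dx dy d rx ry r` says that `(d, r)` is an arithmetical structure on the
bident `D_n` (with `ℓ = n - 3`): `dx, dy, rx, ry` are the values at the prong vertices
`v_x, v_y`, and `d i, r i` (for `0 ≤ i ≤ n - 3`) are the values at the path vertices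
`v_0, v_1, …, v_ℓ`. -/
def IsArith (n dx dy : ℕ) (d : ℕ → ℕ) (rx ry : ℕ) (r : ℕ → ℕ) : Prop :=
  3 ≤ n ∧
  0 < dx ∧ 0 < dy ∧ (∀ i, i ≤ n - 3 → 0 < d i) ∧
  0 < rx ∧ 0 < ry ∧ (∀ i, i ≤ n - 3 → 0 < r i) ∧
  dx * rx = r 0 ∧ dy * ry = r 0 ∧
  (1 ≤ n - 3 → d 0 * r 0 = rx + ry + r 1) ∧
  (n - 3 = 0 → d 0 * r 0 = rx + ry) ∧
  (∀ i, 1 ≤ i → i + 1 ≤ n - 3 → d i * r i = r (i - 1) + r (i + 1)) ∧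
  (1 ≤ n - 3 → d (n - 3) * r (n - 3) = r (n - 3 - 1)) ∧
  (∀ c : ℕ, c ∣ rx → c ∣ ry → (∀ i, i ≤ n - 3 → c ∣ r i) → c = 1)

/-- An arithmetical structure on `D_n` is *smooth* if `d_x, d_y ≥ 2` and `d_i ≥ 2` for all
`1 ≤ i ≤ ℓ = n - 3`. -/
def IsSmooth (n dx dy : ℕ) (d : ℕ → ℕ) : Prop :=
  2 ≤ dx ∧ 2 ≤ dy ∧ ∀ i, 1 ≤ i → i ≤ n - 3 → 2 ≤ d i

/-- The type of arithmetical structures on the bident `D_n`, represented canonically: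
the label functions `d, r` are required to vanish beyond index `n - 3`. -/
structure ArithOn (n : ℕ) where
  dx : ℕ
  dy : ℕ
  d : ℕ → ℕ
  rx : ℕ
  ry : ℕ
  r : ℕ → ℕ
  arith : IsArith n dx dy d rx ry r
  d_pad : ∀ i, n - 3 < i → d i = 0
  r_pad : ∀ i, n - 3 < i → r i = 0

/-- The type of smooth arithmetical structures on the bident `D_n`, represented canonically. -/
structure SmoothArithOn (n : ℕ) where
  dx : ℕ
  dy : ℕ
  d : ℕ → ℕ
  rx : ℕ
  ry : ℕ
  r : ℕ → ℕ
  arith : IsArith n dx dy d rx ry r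
  smooth : IsSmooth n dx dy d
  d_pad : ∀ i, n - 3 < i → d i = 0
  r_pad : ∀ i, n - 3 < i → r i = 0

/-- Adjacency of the bident, with vertex `0 = v_x`, vertex `1 = v_y`, and vertex
`i + 2 = v_i` for `0 ≤ i ≤ n - 3`:  `v_x` and `v_y` are each adjacent to `v_0`, and
consecutive path vertices are adjacent. -/
def bidentAdj (i j : ℕ) : Bool :=
  (i == 0 && j == 2) || (i == 2 && j == 0) || (i == 1 && j == 2) || (i == 2 && j == 1) ||
  (decide (2 ≤ i) && j == i + 1) || (decide (2 ≤ j) && i == j + 1)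

/-- The generalized Laplacian `L(D_n, d) = diag(d) - A` of the bident `D_n`, where `A` is the
adjacency matrix of `D_n` (vertex `0 = v_x`, vertex `1 = v_y`, vertex `i + 2 = v_i`). -/
def bidentLap (n dx dy : ℕ) (d : ℕ → ℕ) : Matrix (Fin n) (Fin n) ℤ :=
  Matrix.diagonal (fun i : Fin n =>
      if (i : ℕ) = 0 then (dx : ℤ) else if (i : ℕ) = 1 then (dy : ℤ) else (d ((i : ℕ) - 2) : ℤ))
    - Matrix.of (fun i j : Fin n => if bidentAdj (i : ℕ) (j : ℕ) then (1 : ℤ) else 0)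

/-- The critical group `K(D_n; d, r)`: the torsion subgroup of the cokernel
`ℤ^n / Image(L(D_n, d))`. -/
def critGroup (n dx dy : ℕ) (d : ℕ → ℕ) :
    Submodule ℤ ((Fin n → ℤ) ⧸ LinearMap.range (Matrix.toLin' (bidentLap n dx dy d))) :=
  Submodule.torsion ℤ ((Fin n → ℤ) ⧸ LinearMap.range (Matrix.toLin' (bidentLap n dx dy d)))

/-- The order of the critical group of an arithmetical structure on `D_n`. -/
noncomputable def critOrder {n : ℕ} (S : ArithOn n) : ℕ := Nat.card (critGroup n S.dx S.dy S.d)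

section Path

/-- A positive sequence `r 0, …, r ℓ`, followed by `0`, in which every entry from `r 1` to `r ℓ`
divides the sum of its neighbours. -/
structure IsArithPath (ℓ : ℕ) (r : ℕ → ℕ) : Prop where
  pos : ∀ i ≤ ℓ, 0 < r i
  dvd : ∀ i < ℓ, r (i + 1) ∣ r i + r (i + 2)
  zero : r (ℓ + 1) = 0

namespace IsArithPath

variable {ℓ s : ℕ} {r : ℕ → ℕ}

lemma last_dvd (h : IsArithPath ℓ r) {i : ℕ} (hi : i ≤ ℓ) : r ℓ ∣ r i := by
  suffices H : ∀ j ≤ ℓ, r ℓ ∣ r (ℓ - j) ∧ r ℓ ∣ r (ℓ - j + 1) by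
    have := (H (ℓ - i) (by omega)).1
    rwa [Nat.sub_sub_self hi] at this
  intro j
  induction j with
  | zero => simp [h.zero]
  | succ j ih =>
    intro hj
    obtain ⟨h1, h2⟩ := ih (by omega)
    have e : ℓ - j = ℓ - (j + 1) + 1 := by omega
    rw [e] at h1 h2
    exact ⟨(Nat.dvd_add_left h2).1 (h1.trans (h.dvd _ (by omega))), h1⟩

lemma dvd_of_dvd_zero_one (h : IsArithPath ℓ r) {c : ℕ} (h0 : c ∣ r 0) (h1 : c ∣ r 1)
    {i : ℕ} (hi : i ≤ ℓ) : c ∣ r i := by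
  suffices H : ∀ i ≤ ℓ, c ∣ r i ∧ c ∣ r (i + 1) from (H i hi).1
  intro i
  induction i with
  | zero => exact fun _ => ⟨h0, h1⟩
  | succ i ih =>
    intro hi
    obtain ⟨h2, h3⟩ := ih (by omega)
    exact ⟨h3, (Nat.dvd_add_right h2).1 (h3.trans (h.dvd i (by omega)))⟩

/-- An entry equal to the sum of its neighbours can be deleted. -/
lemma contract (h : IsArithPath (ℓ + 1) r) {i : ℕ} (hi : i < ℓ + 1)
    (e : r (i + 1) = r i + r (i + 2)) :
    IsArithPath ℓ (fun j => if j ≤ i then r j else r (j + 1)) where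
  pos j hj := by
    split_ifs
    · exact h.pos j (by omega)
    · exact h.pos _ (by omega)
  dvd j hj := by
    rcases lt_trichotomy (j + 1) i with hji | hji | hji
    · rw [if_pos (by omega), if_pos (by omega), if_pos (by omega)]
      exact h.dvd j (by omega)
    · subst hji
      rw [if_pos (by omega), if_pos (by omega), if_neg (by omega)]
      have := h.dvd j (by omega)
      rw [show j + 2 = j + 1 + 1 by ring, e, add_comm (r (j + 1)), ← add_assoc] at this
      exact (Nat.dvd_add_left dvd_rfl).1 this
    · rcases Nat.lt_or_ge i j with hij | hij
      · rw [if_neg (by omega), if_neg (by omega), if_neg (by omega)]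
        exact h.dvd (j + 1) (by omega)
      · obtain rfl : j = i := by omega
        rw [if_neg (by omega), if_pos (by omega), if_neg (by omega)]
        have := h.dvd (j + 1) (by omega)
        rw [e, show j + 1 + 1 = j + 2 by ring, add_right_comm] at this
        exact (Nat.dvd_add_left dvd_rfl).1 this
  zero := by
    rw [if_neg (by omega)]
    exact h.zero

/-- Slope bound for a convex path. -/
lemma le_add_of_convex (h : IsArithPath ℓ r) (hc : ∀ i < ℓ, 2 * r (i + 1) ≤ r i + r (i + 2))
    (hs : 0 < s) (h1 : r 0 ∣ r 1 + s) {i : ℕ} (hi : i < ℓ) : r i ≤ r (i + 1) + s := by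
  have dec : ∀ j ≤ ℓ, r (ℓ - j + 1) < r (ℓ - j) := by
    intro j
    induction j with
    | zero => intro _; simpa [h.zero] using h.pos ℓ le_rfl
    | succ j ih =>
      intro hj
      have := ih (by omega)
      have := hc (ℓ - (j + 1)) (by omega)
      have e : ℓ - j = ℓ - (j + 1) + 1 := by omega
      rw [e] at *
      grind
  induction i with
  | zero => exact Nat.le_of_dvd (by omega) h1
  | succ i ih =>
    have := ih (by omega)
    have := hc i (by omega)
    grind

lemma convex_sum (hle : ∀ i < ℓ, r i ≤ r (i + 1) + s) {i j : ℕ} (hij : i + j ≤ ℓ) :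
    r i ≤ r (i + j) + j * s := by
  induction j with
  | zero => simp
  | succ j ih =>
    have := ih (by omega)
    have := hle (i + j) (by omega)
    rw [add_mul, ← add_assoc i]
    omega

lemma convex_or_exists (h : IsArithPath ℓ r) :
    (∀ i < ℓ, 2 * r (i + 1) ≤ r i + r (i + 2)) ∨ ∃ i < ℓ, r (i + 1) = r i + r (i + 2) := by
  by_contra! hcon
  obtain ⟨⟨i, hi, hlt⟩, hne⟩ := hcon
  obtain ⟨c, hc⟩ := h.dvd i hi
  have := h.pos i (by omega)
  have := hne i hi
  rcases c with _ | _ | c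
  · omega
  · omega
  · nlinarith

lemma exists_contract (h : IsArithPath (ℓ + 1) r) (h1 : r 0 ∣ r 1 + s) {i : ℕ} (hi : i < ℓ + 1)
    (e : r (i + 1) = r i + r (i + 2)) :
    ∃ t, IsArithPath ℓ t ∧ t 0 = r 0 ∧ t ℓ ≤ r (ℓ + 1) ∧ t 0 ∣ t 1 + s := by
  refine ⟨_, h.contract hi e, if_pos (Nat.zero_le _), ?_, ?_⟩
  · split_ifs with hli
    · obtain rfl : i = ℓ := by omega
      omega
    · exact le_rfl
  · rw [if_pos (Nat.zero_le _)]
    split_ifs with hi1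
    · exact h1
    · obtain rfl : i = 0 := by omega
      rw [zero_add, add_comm (r 0), zero_add] at e
      rw [e, add_right_comm] at h1
      exact (Nat.dvd_add_left dvd_rfl).1 h1

lemma zero_le (h : IsArithPath ℓ r) (hs : 0 < s) (h1 : r 0 ∣ r 1 + s) :
    r 0 ≤ ℓ * s + r ℓ := by
  induction ℓ generalizing r with
  | zero => simp
  | succ ℓ ih =>
    rcases h.convex_or_exists with hc | ⟨i, hi, e⟩
    · have hle := fun i hi => h.le_add_of_convex (i := i) hc hs h1 hi
      have := convex_sum hle (i := 0) (j := ℓ + 1) (by omega)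
      rw [zero_add] at this
      omega
    · obtain ⟨t, ht, ht0, htl, ht1⟩ := h.exists_contract h1 hi e
      have := ih ht ht1
      rw [add_mul]
      omega

/-- Equality in `IsArithPath.zero_le` forces an arithmetic progression. -/
lemma eq_of_zero_eq (h : IsArithPath ℓ r) (hs : 0 < s) (h1 : r 0 ∣ r 1 + s)
    (heq : r 0 = ℓ * s + r ℓ) {i : ℕ} (hi : i ≤ ℓ) : r i + i * s = r 0 := by
  rcases h.convex_or_exists with hc | ⟨j, hj, e⟩
  · have hle := fun i hi => h.le_add_of_convex (i := i) hc hs h1 hi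
    have key1 := convex_sum hle (i := 0) (j := i) (by omega)
    have key2 := convex_sum hle (i := i) (j := ℓ - i) (by omega)
    rw [zero_add] at key1
    rw [Nat.add_sub_cancel' hi] at key2
    obtain ⟨t, rfl⟩ := Nat.exists_eq_add_of_le hi
    rw [Nat.add_sub_cancel_left] at key2
    rw [add_mul] at heq
    omega
  · exfalso
    obtain ⟨k, rfl⟩ : ∃ k, ℓ = k + 1 := ⟨ℓ - 1, by omega⟩
    obtain ⟨t, ht, ht0, htl, ht1⟩ := h.exists_contract h1 hj e
    have := ht.zero_le hs ht1
    rw [add_mul] at heq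
    omega

end IsArithPath

end Path

section CriticalGroup

/-- A family on the vertices of `D_{ℓ+3}` (with `v_x, v_y, v_0, v_1, …` at `0, 1, 2, 3, …`)
annihilated by the Laplacian. -/
def IsBidentHarmonic {M : Type*} [AddCommGroup M] (ℓ dx dy : ℕ) (d : ℕ → ℕ) (h : ℕ → M) : Prop :=
  dx • h 0 = h 2 ∧ dy • h 1 = h 2 ∧ d 0 • h 2 = h 0 + h 1 + h 3 ∧
    ∀ i < ℓ, d (i + 1) • h (i + 3) = h (i + 2) + h (i + 4)

lemma sum_bidentLap_smul {M : Type*} [AddCommGroup M] (ℓ dx dy : ℕ) (d : ℕ → ℕ) (h : ℕ → M)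
    (j : Fin (ℓ + 3)) :
    ∑ i, bidentLap (ℓ + 3) dx dy d i j • h i =
      (if (j : ℕ) = 0 then dx else if (j : ℕ) = 1 then dy else d (j - 2)) • h j -
        ∑ i ∈ Finset.range (ℓ + 3), if bidentAdj i j then h i else 0 := by
  rw [← Fin.sum_univ_eq_sum_range (fun i => if bidentAdj i j then h i else 0)]
  simp only [bidentLap, Matrix.sub_apply, sub_smul, Finset.sum_sub_distrib, Matrix.of_apply,
    ite_smul, one_smul, zero_smul, Matrix.diagonal_apply]
  congr 1
  rw [Finset.sum_ite_eq' Finset.univ j, if_pos (Finset.mem_univ _)]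
  split_ifs <;> simp

lemma sum_bidentAdj {M : Type*} [AddCommGroup M] (ℓ : ℕ) (h : ℕ → M) (hz : h (ℓ + 3) = 0)
    {j : ℕ} (hj : j < ℓ + 3) :
    (∑ i ∈ Finset.range (ℓ + 3), if bidentAdj i j then h i else 0) =
      if j = 0 then h 2 else if j = 1 then h 2 else if j = 2 then h 0 + h 1 + h 3
      else h (j - 1) + h (j + 1) := by
  have hz' : ∀ k ≤ ℓ + 3, (if k < ℓ + 3 then h k else 0) = h k := by
    intro k hk
    split_ifs
    · rfl
    · rw [show k = ℓ + 3 by omega, hz]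
  have key : ∀ k ≤ ℓ + 3, (∑ i ∈ Finset.range (ℓ + 3), if i = k then h i else 0) = h k := by
    intro k hk
    rw [Finset.sum_ite_eq' (Finset.range (ℓ + 3)) k]
    simpa using hz' k hk
  split_ifs with h0 h1 h2
  · rw [← key 2 (by omega)]
    refine Finset.sum_congr rfl fun i _ => if_congr ?_ rfl rfl
    simp only [bidentAdj]; grind
  · rw [← key 2 (by omega)]
    refine Finset.sum_congr rfl fun i _ => if_congr ?_ rfl rfl
    simp only [bidentAdj]; grind
  · rw [← key 0 (by omega), ← key 1 (by omega), ← key 3 (by omega), ← Finset.sum_add_distrib,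
      ← Finset.sum_add_distrib]
    refine Finset.sum_congr rfl fun i _ => ?_
    have : (bidentAdj i j = true) ↔ i = 0 ∨ i = 1 ∨ i = 3 := by simp only [bidentAdj]; grind
    simp only [this]
    split_ifs <;> first | omega | simp
  · rw [← key (j - 1) (by omega), ← key (j + 1) (by omega), ← Finset.sum_add_distrib]
    refine Finset.sum_congr rfl fun i _ => ?_
    have : (bidentAdj i j = true) ↔ i = j - 1 ∨ i = j + 1 := by simp only [bidentAdj]; grind
    simp only [this]
    split_ifs <;> first | omega | simp

lemma isBidentHarmonic_iff {M : Type*} [AddCommGroup M] {ℓ dx dy : ℕ} {d : ℕ → ℕ} {h : ℕ → M}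
    (hz : h (ℓ + 3) = 0) :
    IsBidentHarmonic ℓ dx dy d h ↔
      ∀ j, ∑ i, bidentLap (ℓ + 3) dx dy d i j • h i = 0 := by
  simp only [sum_bidentLap_smul, sub_eq_zero]
  constructor
  · rintro ⟨h1, h2, h3, h4⟩ ⟨j, hj⟩
    rw [sum_bidentAdj ℓ h hz hj]
    rcases j with _ | _ | _ | j
    · simpa using h1
    · simpa using h2
    · simpa using h3
    · simpa using h4 j (by omega)
  · intro H
    refine ⟨?_, ?_, ?_, fun i hi => ?_⟩
    · simpa [sum_bidentAdj ℓ h hz] using H ⟨0, by omega⟩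
    · simpa [sum_bidentAdj ℓ h hz] using H ⟨1, by omega⟩
    · simpa [sum_bidentAdj ℓ h hz] using H ⟨2, by omega⟩
    · have hi' : i + 3 < ℓ + 3 := by omega
      simpa [sum_bidentAdj ℓ h hz hi'] using H ⟨i + 3, hi'⟩

/-- The cokernel of the Laplacian. -/
abbrev BidentCoker (ℓ dx dy : ℕ) (d : ℕ → ℕ) : Type :=
  (Fin (ℓ + 3) → ℤ) ⧸ LinearMap.range (Matrix.toLin' (bidentLap (ℓ + 3) dx dy d))

/-- The class of a vertex in the cokernel. -/
def bidentVertex (ℓ dx dy : ℕ) (d : ℕ → ℕ) (j : ℕ) : BidentCoker ℓ dx dy d :=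
  if hj : j < ℓ + 3 then Submodule.Quotient.mk (Pi.single ⟨j, hj⟩ 1) else 0

lemma mk_eq_sum_bidentVertex {ℓ dx dy : ℕ} {d : ℕ → ℕ} (v : Fin (ℓ + 3) → ℤ) :
    (Submodule.Quotient.mk v : BidentCoker ℓ dx dy d) =
      ∑ i : Fin (ℓ + 3), v i • bidentVertex ℓ dx dy d i := by
  conv_lhs => rw [pi_eq_sum_univ' v]
  rw [← Submodule.mkQ_apply, map_sum]
  refine Finset.sum_congr rfl fun i _ => ?_
  rw [map_smul, bidentVertex, dif_pos i.2, Submodule.mkQ_apply]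

lemma isBidentHarmonic_bidentVertex (ℓ dx dy : ℕ) (d : ℕ → ℕ) :
    IsBidentHarmonic ℓ dx dy d (bidentVertex ℓ dx dy d) := by
  rw [isBidentHarmonic_iff (by simp [bidentVertex])]
  intro j
  rw [← mk_eq_sum_bidentVertex (fun i => bidentLap (ℓ + 3) dx dy d i j),
    Submodule.Quotient.mk_eq_zero]
  refine ⟨Pi.single j 1, ?_⟩
  rw [Matrix.toLin'_apply, Matrix.mulVec_single_one]
  rfl

lemma exists_linearMap_bidentVertex {M : Type*} [AddCommGroup M] {ℓ dx dy : ℕ} {d : ℕ → ℕ}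
    {h : ℕ → M} (hz : h (ℓ + 3) = 0) (hh : IsBidentHarmonic ℓ dx dy d h) :
    ∃ f : BidentCoker ℓ dx dy d →ₗ[ℤ] M, ∀ j < ℓ + 3, f (bidentVertex ℓ dx dy d j) = h j := by
  rw [isBidentHarmonic_iff hz] at hh
  refine ⟨Submodule.liftQ _ (Fintype.linearCombination ℤ (fun i : Fin (ℓ + 3) => h i)) ?_, ?_⟩
  · rintro _ ⟨v, rfl⟩
    simp only [LinearMap.mem_ker, Fintype.linearCombination_apply, Matrix.toLin'_apply,
      Matrix.mulVec, dotProduct, Finset.sum_smul]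
    rw [Finset.sum_comm]
    refine Finset.sum_eq_zero fun j _ => ?_
    rw [← smul_zero (v j), ← hh j, Finset.smul_sum]
    simp [smul_smul, mul_comm]
  · intro j hj
    rw [bidentVertex, dif_pos hj, ← Submodule.mkQ_apply, Submodule.mkQ_apply,
      Submodule.liftQ_apply, Fintype.linearCombination_apply_single, one_smul]

lemma card_torsion_eq {Q : Type*} [AddCommGroup Q] {K : ℕ} (hK : 0 < K) (φ : Q →ₗ[ℤ] ℤ)
    (ψ : Q →ₗ[ℤ] ZMod K) (w : Q) (hw : (K : ℤ) • w = 0) (hψ : ψ w = 1)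
    (hker : ∀ x, φ x = 0 → ∃ t : ℤ, x = t • w) :
    Nat.card (Submodule.torsion ℤ Q) = K := by
  have hφ : ∀ x ∈ Submodule.torsion ℤ Q, ∃ t : ℤ, x = t • w := by
    rintro x ⟨⟨a, ha⟩, hx⟩
    refine hker x ?_
    have : a * φ x = 0 := by
      rw [← smul_eq_mul, ← map_smul]
      exact (congrArg φ hx).trans (map_zero φ)
    exact (mul_eq_zero.1 this).resolve_left (nonZeroDivisors.ne_zero ha)
  have hψt : ∀ t : ℤ, ψ (t • w) = t := by simp [hψ]
  have hbij : Function.Bijective (fun x : Submodule.torsion ℤ Q => ψ x) := by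
    constructor
    · rintro ⟨x, hx⟩ ⟨y, hy⟩ hxy
      obtain ⟨t, rfl⟩ := hφ x hx
      obtain ⟨u, rfl⟩ := hφ y hy
      simp only [hψt] at hxy
      obtain ⟨c, hc⟩ := (ZMod.intCast_eq_intCast_iff_dvd_sub _ _ _).1 hxy
      rw [Subtype.mk.injEq, eq_comm, ← sub_eq_zero, ← sub_smul, hc, mul_comm, mul_smul, hw,
        smul_zero]
    · intro z
      obtain ⟨t, rfl⟩ := ZMod.intCast_surjective z
      refine ⟨⟨t • w, ⟨⟨(K : ℤ), mem_nonZeroDivisors_of_ne_zero (by exact_mod_cast hK.ne')⟩, ?_⟩⟩,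
        hψt t⟩
      change (K : ℤ) • t • w = 0
      rw [smul_comm, hw, smul_zero]
  rw [Nat.card_eq_of_bijective _ hbij, Nat.card_zmod]

lemma eq_smul_last_of_recurrence {M : Type*} [AddCommGroup M] {ℓ : ℕ} {d c : ℕ → ℕ} {x : ℕ → M}
    (hx : ∀ i < ℓ, d (i + 1) • x (i + 1) = x i + x (i + 2)) (hxz : x (ℓ + 1) = 0)
    (hc : ∀ i < ℓ, d (i + 1) * c (i + 1) = c i + c (i + 2)) (hcz : c (ℓ + 1) = 0)
    (hc1 : c ℓ = 1) {i : ℕ} (hi : i ≤ ℓ + 1) : x i = c i • x ℓ := by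
  suffices H : ∀ j ≤ ℓ, x (ℓ - j) = c (ℓ - j) • x ℓ ∧ x (ℓ - j + 1) = c (ℓ - j + 1) • x ℓ by
    rcases hi.lt_or_eq with hi | rfl
    · have := (H (ℓ - i) (by omega)).1
      rwa [Nat.sub_sub_self (by omega)] at this
    · simp [hcz, hxz]
  intro j
  induction j with
  | zero => simp [hc1, hcz, hxz]
  | succ j ih =>
    intro hj
    obtain ⟨h1, h2⟩ := ih (by omega)
    rw [show ℓ - j = ℓ - (j + 1) + 1 by omega] at h1 h2
    refine ⟨?_, h1⟩
    have e1 := hx (ℓ - (j + 1)) (by omega)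
    have e2 := congrArg (fun k => k • x ℓ) (hc (ℓ - (j + 1)) (by omega))
    simp only [mul_smul, add_smul] at e2
    rw [h1] at e1
    rw [h2, e2] at e1
    exact (add_right_cancel e1).symm

lemma smul_sub_eq_zero_of_coprime {Q : Type*} [AddCommGroup Q] {a b g K D : ℤ} {x y : Q}
    (hD : a + b = g * D) (hab : IsCoprime a b) (h1 : (b * g * K) • x = (a * b * K) • y)
    (h2 : (a * g * K) • (D • y - x) = (a * b * K) • y) : K • (g • x - a • y) = 0 := by
  obtain ⟨p, q, hpq⟩ := hab
  have hb : b • K • (g • x - a • y) = 0 := by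
    rw [← sub_eq_zero] at h1
    rw [← h1]
    module
  have ha : a • K • (g • x - a • y) = 0 := by
    have hy : (a * b * K) • y = (a * g * K * D - a * a * K) • y := by
      congr 1
      linear_combination (a * K) * hD
    rw [hy, ← sub_eq_zero] at h2
    rw [← neg_eq_zero, ← h2]
    module
  rw [← one_smul ℤ (K • _), ← hpq, add_smul, mul_smul, mul_smul, ha, hb, smul_zero, smul_zero,
    add_zero]

end CriticalGroup

namespace ArithOn

variable {ℓ : ℕ} (S : ArithOn (ℓ + 3))

lemma r_last_succ : S.r (ℓ + 1) = 0 := S.r_pad _ (by omega)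

lemma r_pos {i : ℕ} (hi : i ≤ ℓ) : 0 < S.r i := S.arith.2.2.2.2.2.2.1 i hi

lemma rx_pos : 0 < S.rx := S.arith.2.2.2.2.1

lemma ry_pos : 0 < S.ry := S.arith.2.2.2.2.2.1

lemma dx_mul : S.dx * S.rx = S.r 0 := S.arith.2.2.2.2.2.2.2.1

lemma dy_mul : S.dy * S.ry = S.r 0 := S.arith.2.2.2.2.2.2.2.2.1

lemma d_zero_mul : S.d 0 * S.r 0 = S.rx + S.ry + S.r 1 := by
  obtain ⟨-, -, -, -, -, -, -, -, -, h1, h2, -⟩ := S.arith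
  rcases Nat.eq_zero_or_pos ℓ with rfl | h
  · rw [S.r_last_succ]
    exact h2 rfl
  · exact h1 h

lemma d_mul {i : ℕ} (hi : i < ℓ) : S.d (i + 1) * S.r (i + 1) = S.r i + S.r (i + 2) := by
  obtain ⟨-, -, -, -, -, -, -, -, -, -, -, h1, h2, -⟩ := S.arith
  simp only [Nat.add_sub_cancel] at h1 h2
  rcases (Nat.succ_le_of_lt hi).lt_or_eq with h | rfl
  · exact h1 (i + 1) (by omega) (by omega)
  · have := S.r_last_succ
    simp only [Nat.succ_eq_add_one] at *
    rw [this]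
    exact h2 (by omega)

lemma eq_one_of_dvd {c : ℕ} (hx : c ∣ S.rx) (hy : c ∣ S.ry) (h : ∀ i ≤ ℓ, c ∣ S.r i) : c = 1 :=
  S.arith.2.2.2.2.2.2.2.2.2.2.2.2.2 c hx hy h

lemma isArithPath : IsArithPath ℓ S.r where
  pos _ hi := S.r_pos hi
  dvd _ hi := Dvd.intro_left _ (S.d_mul hi)
  zero := S.r_last_succ

lemma zero_dvd : S.r 0 ∣ S.r 1 + (S.rx + S.ry) :=
  Dvd.intro_left _ (S.d_zero_mul.trans (add_comm _ _))

lemma last_dvd_succ {i : ℕ} (hi : i ≤ ℓ + 1) : S.r ℓ ∣ S.r i := by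
  rcases hi.lt_or_eq with hi | rfl
  · exact S.isArithPath.last_dvd (by omega)
  · simp [S.r_last_succ]

lemma coprime_rx_ry : Nat.Coprime S.rx S.ry := by
  refine S.eq_one_of_dvd (Nat.gcd_dvd_left _ _) (Nat.gcd_dvd_right _ _) fun i hi => ?_
  have h0 : Nat.gcd S.rx S.ry ∣ S.r 0 := (Nat.gcd_dvd_left _ _).trans (Dvd.intro_left _ S.dx_mul)
  exact S.isArithPath.dvd_of_dvd_zero_one h0 ((Nat.dvd_add_left
    ((Nat.gcd_dvd_left _ _).add (Nat.gcd_dvd_right _ _))).1 (h0.trans S.zero_dvd)) hi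

lemma last_dvd_add : S.r ℓ ∣ S.rx + S.ry :=
  (Nat.dvd_add_right (S.last_dvd_succ (by omega))).1
    ((S.last_dvd_succ (Nat.zero_le _)).trans S.zero_dvd)

lemma coprime_rx_last : Nat.Coprime S.rx (S.r ℓ) := by
  refine S.eq_one_of_dvd (Nat.gcd_dvd_left _ _) ?_
    fun i hi => (Nat.gcd_dvd_right _ _).trans (S.isArithPath.last_dvd hi)
  exact (Nat.dvd_add_right (Nat.gcd_dvd_left _ _)).1 ((Nat.gcd_dvd_right _ _).trans S.last_dvd_add)

lemma coprime_ry_last : Nat.Coprime S.ry (S.r ℓ) := by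
  refine S.eq_one_of_dvd ?_ (Nat.gcd_dvd_left _ _)
    fun i hi => (Nat.gcd_dvd_right _ _).trans (S.isArithPath.last_dvd hi)
  exact (Nat.dvd_add_left (Nat.gcd_dvd_left _ _)).1 ((Nat.gcd_dvd_right _ _).trans S.last_dvd_add)

lemma prod_dvd : S.rx * S.ry * S.r ℓ ∣ S.r 0 :=
  (Nat.Coprime.mul_left S.coprime_rx_last S.coprime_ry_last).mul_dvd_of_dvd_of_dvd
    (S.coprime_rx_ry.mul_dvd_of_dvd_of_dvd (Dvd.intro_left _ S.dx_mul) (Dvd.intro_left _ S.dy_mul))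
    (S.last_dvd_succ (Nat.zero_le _))

/-- The order of the critical group is `r_0 / (r_x r_y r_ℓ)`. -/
lemma critOrder_mul : critOrder S * (S.rx * S.ry * S.r ℓ) = S.r 0 := by
  obtain ⟨K, hK⟩ := S.prod_dvd
  have h0 := S.r_pos (Nat.zero_le ℓ)
  have hKpos : 0 < K := Nat.pos_of_ne_zero (by rintro rfl; omega)
  suffices critOrder S = K by rw [this, hK, mul_comm]
  have ha := S.rx_pos
  have hb := S.ry_pos
  have hg := S.r_pos le_rfl
  obtain ⟨c, hc⟩ : ∃ c : ℕ → ℕ, ∀ i ≤ ℓ + 1, S.r i = S.r ℓ * c i :=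
    ⟨fun i => S.r i / S.r ℓ, fun i hi => (Nat.mul_div_cancel' (S.last_dvd_succ hi)).symm⟩
  have hcrec : ∀ i < ℓ, S.d (i + 1) * c (i + 1) = c i + c (i + 2) := by
    intro i hi
    have := S.d_mul hi
    rw [hc _ (by omega), hc i (by omega), hc (i + 2) (by omega)] at this
    exact Nat.eq_of_mul_eq_mul_left hg (by linarith)
  have hcz : c (ℓ + 1) = 0 := by
    have := hc _ le_rfl
    rw [S.r_last_succ] at this
    simpa [hg.ne'] using this.symm
  have hc1 : c ℓ = 1 := by
    have := hc ℓ (by omega)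
    exact Nat.eq_of_mul_eq_mul_left hg (by omega)
  have hc0 : c 0 = S.rx * S.ry * K :=
    Nat.eq_of_mul_eq_mul_left hg (by rw [← hc 0 (by omega), hK]; ring)
  have hdx : S.dx = S.ry * S.r ℓ * K :=
    Nat.eq_of_mul_eq_mul_right ha (by rw [S.dx_mul, hK]; ring)
  have hdy : S.dy = S.rx * S.r ℓ * K :=
    Nat.eq_of_mul_eq_mul_right hb (by rw [S.dy_mul, hK]; ring)
  obtain ⟨D, hD⟩ := S.last_dvd_add
  have hcD : S.d 0 * c 0 = D + c 1 := by
    have := S.d_zero_mul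
    rw [hD, hc 0 (by omega), hc 1 (by omega)] at this
    exact Nat.eq_of_mul_eq_mul_left hg (by linarith)
  -- the two functionals separating the cokernel
  obtain ⟨φ, hφ⟩ := exists_linearMap_bidentVertex (M := ℤ) (ℓ := ℓ) (dx := S.dx) (dy := S.dy)
    (d := S.d) (h := fun j => match j with
      | 0 => (S.rx : ℤ) | 1 => (S.ry : ℤ) | i + 2 => (S.r i : ℤ))
    (by simp [S.r_last_succ])
    (by
      refine ⟨?_, ?_, ?_, fun i hi => ?_⟩
      · simpa using mod_cast S.dx_mul
      · simpa using mod_cast S.dy_mul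
      · simpa using mod_cast S.d_zero_mul
      · simpa using mod_cast S.d_mul hi)
  obtain ⟨u, v, huv⟩ : ∃ u v : ℤ, u * S.r ℓ - v * S.rx = 1 := by
    obtain ⟨u, v, h⟩ := Nat.isCoprime_iff_coprime.2 S.coprime_rx_last
    exact ⟨v, -u, by linarith⟩
  obtain ⟨ψ, hψ⟩ := exists_linearMap_bidentVertex (M := ZMod K) (ℓ := ℓ) (dx := S.dx)
    (dy := S.dy) (d := S.d) (h := fun j => match j with
      | 0 => (u : ZMod K) | 1 => (D * v - u : ZMod K) | i + 2 => (c i * v : ZMod K))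
    (by simp [hcz])
    (by
      refine ⟨?_, ?_, ?_, fun i hi => ?_⟩
      · simp [hdx, hc0]
      · simp [hdy, hc0]
      · have := congrArg (Nat.cast (R := ZMod K)) hcD
        push_cast at this
        simp only [nsmul_eq_mul]
        linear_combination (v : ZMod K) * this
      · have := congrArg (Nat.cast (R := ZMod K)) (hcrec i hi)
        push_cast at this
        simp only [nsmul_eq_mul]
        linear_combination (v : ZMod K) * this)
  obtain ⟨hE1, hE2, hE3, hE4⟩ := isBidentHarmonic_bidentVertex ℓ S.dx S.dy S.d
  have hφ0 := hφ 0 (by omega)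
  have hφl := hφ (ℓ + 2) (by omega)
  have hψ0 := hψ 0 (by omega)
  have hψl := hψ (ℓ + 2) (by omega)
  have hEz : bidentVertex ℓ S.dx S.dy S.d (ℓ + 3) = 0 := by simp [bidentVertex]
  have hgen := fun x => mk_eq_sum_bidentVertex (dx := S.dx) (dy := S.dy) (d := S.d) (ℓ := ℓ) x
  set E := bidentVertex ℓ S.dx S.dy S.d
  clear_value E
  simp only at hφ0 hφl hψ0 hψl
  have hEc : ∀ i ≤ ℓ + 1, E (i + 2) = c i • E (ℓ + 2) := fun i hi =>
    eq_smul_last_of_recurrence (x := fun i => E (i + 2)) (d := S.d) hE4 hEz hcrec hcz hc1 hi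
  have hE1' : E 1 = (D : ℤ) • E (ℓ + 2) - E 0 := by
    rw [hEc 0 (by omega), hEc 1 (by omega), smul_smul, hcD, add_smul] at hE3
    rw [natCast_zsmul, eq_sub_iff_add_eq, add_comm (E 1)]
    exact (add_right_cancel hE3).symm
  have hspan : ∀ x, ∃ α β : ℤ, α • E 0 + β • E (ℓ + 2) = x := by
    intro x
    obtain ⟨f, rfl⟩ := Submodule.Quotient.mk_surjective _ x
    rw [← Submodule.mem_span_pair, hgen]
    refine Submodule.sum_mem _ fun i _ => Submodule.smul_mem _ _ ?_
    rw [Submodule.mem_span_pair]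
    obtain ⟨i, hi⟩ := i
    rcases i with _ | _ | i
    · exact ⟨1, 0, by simp⟩
    · exact ⟨-1, D, by simp only [zero_add]; rw [hE1']; module⟩
    · exact ⟨0, c i, by simp only; rw [hEc i (by omega)]; simp⟩
  have hdx' : (S.ry * S.r ℓ * K : ℤ) = (S.dx : ℕ) := mod_cast hdx.symm
  have hdy' : (S.rx * S.r ℓ * K : ℤ) = (S.dy : ℕ) := mod_cast hdy.symm
  have hc0' : (S.rx * S.ry * K : ℤ) = (c 0 : ℕ) := mod_cast hc0.symm
  have hD' : (S.rx + S.ry : ℤ) = S.r ℓ * D := mod_cast hD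
  refine card_torsion_eq hKpos φ ψ ((S.r ℓ : ℤ) • E 0 - (S.rx : ℤ) • E (ℓ + 2)) ?_ ?_ ?_
  · refine smul_sub_eq_zero_of_coprime hD' (Nat.isCoprime_iff_coprime.2 S.coprime_rx_ry) ?_ ?_
    · rw [hdx', hc0', natCast_zsmul, natCast_zsmul, hE1, hEc 0 (by omega)]
    · rw [← hE1', hdy', hc0', natCast_zsmul, natCast_zsmul, hE2, hEc 0 (by omega)]
  · rw [map_sub, map_smul, map_smul, hψ0, hψl, hc1]
    have := congrArg (Int.cast (R := ZMod K)) huv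
    push_cast at this
    simp only [zsmul_eq_mul]
    push_cast
    linear_combination this
  · intro x hx
    obtain ⟨α, β, rfl⟩ := hspan x
    rw [map_add, map_smul, map_smul, hφ0, hφl, smul_eq_mul, smul_eq_mul] at hx
    have hdvd : (S.r ℓ : ℤ) ∣ α := by
      refine (Nat.isCoprime_iff_coprime.2 S.coprime_rx_last.symm).dvd_of_dvd_mul_right ?_
      exact ⟨-β, by linear_combination hx⟩
    obtain ⟨t, rfl⟩ := hdvd
    have hβ : β = -(t * S.rx) := by
      have hg' : (S.r ℓ : ℤ) ≠ 0 := mod_cast hg.ne'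
      apply mul_left_cancel₀ hg'
      linear_combination hx
    exact ⟨t, by rw [hβ]; module⟩

lemma ext_of_r {S T : ArithOn (ℓ + 3)} (hx : S.rx = T.rx) (hy : S.ry = T.ry)
    (h : ∀ i ≤ ℓ, S.r i = T.r i) : S = T := by
  have hr : S.r = T.r := by
    funext i
    rcases le_or_gt i ℓ with hi | hi
    · exact h i hi
    · rw [S.r_pad i (by omega), T.r_pad i (by omega)]
  have hdx : S.dx = T.dx := Nat.eq_of_mul_eq_mul_right S.rx_pos (by
    rw [S.dx_mul, hx, T.dx_mul, hr])
  have hdy : S.dy = T.dy := Nat.eq_of_mul_eq_mul_right S.ry_pos (by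
    rw [S.dy_mul, hy, T.dy_mul, hr])
  have hd : S.d = T.d := by
    funext i
    rcases le_or_gt i ℓ with hi | hi
    · refine Nat.eq_of_mul_eq_mul_right (S.r_pos hi) ?_
      rcases i with _ | i
      · rw [S.d_zero_mul, hr, T.d_zero_mul, hx, hy]
      · rw [S.d_mul (by omega), hr, T.d_mul (by omega)]
    · rw [S.d_pad i (by omega), T.d_pad i (by omega)]
  cases S
  cases T
  simp_all

/-- An arithmetical structure is determined by divisibility conditions on `r`. -/
lemma exists_of_r {rx ry : ℕ} {r : ℕ → ℕ} (hr : IsArithPath ℓ r) (hpad : ∀ i, ℓ < i → r i = 0)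
    (hx : rx ∣ r 0) (hy : ry ∣ r 0) (h0 : r 0 ∣ r 1 + (rx + ry)) (hl : r ℓ = 1) :
    ∃ S : ArithOn (ℓ + 3), S.rx = rx ∧ S.ry = ry ∧ S.r = r := by
  have hr0 := hr.pos 0 (Nat.zero_le _)
  obtain ⟨dx, hdx⟩ := hx
  obtain ⟨dy, hdy⟩ := hy
  obtain ⟨d0, hd0⟩ := h0
  have hrx : 0 < rx := Nat.pos_of_ne_zero (by rintro rfl; omega)
  have hry : 0 < ry := Nat.pos_of_ne_zero (by rintro rfl; omega)
  have hd : ∀ i < ℓ, (r i + r (i + 2)) / r (i + 1) * r (i + 1) = r i + r (i + 2) :=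
    fun i hi => Nat.div_mul_cancel (hr.dvd i hi)
  let d : ℕ → ℕ := fun i => match i with
    | 0 => d0
    | i + 1 => if i < ℓ then (r i + r (i + 2)) / r (i + 1) else 0
  have hdsucc : ∀ i < ℓ, d (i + 1) * r (i + 1) = r i + r (i + 2) := by
    intro i hi
    simp only [d, if_pos hi, hd i hi]
  have hdzero : d 0 * r 0 = rx + ry + r 1 := by
    simp only [d]
    linarith
  refine ⟨⟨dx, dy, d, rx, ry, r, ⟨by omega, ?_, ?_, ?_, hrx, hry, hr.pos, ?_, ?_, ?_, ?_, ?_, ?_,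
    ?_⟩, ?_, hpad⟩, rfl, rfl, rfl⟩
  · exact Nat.pos_of_ne_zero (by rintro rfl; omega)
  · exact Nat.pos_of_ne_zero (by rintro rfl; omega)
  · intro i hi
    refine Nat.pos_of_ne_zero fun h => ?_
    rcases i with _ | i
    · rw [h] at hdzero
      omega
    · have := hdsucc i (by omega)
      have := hr.pos i (by omega)
      rw [h] at *
      omega
  · rw [hdx, mul_comm]
  · rw [hdy, mul_comm]
  · exact fun _ => hdzero
  · intro h
    obtain rfl : ℓ = 0 := h
    rw [hdzero, hr.zero, add_zero]
  · intro i hi hi'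
    obtain ⟨i, rfl⟩ := Nat.exists_eq_add_of_le' hi
    exact hdsucc i (by omega)
  · intro h
    obtain ⟨k, rfl⟩ := Nat.exists_eq_add_of_le' (show 1 ≤ ℓ from h)
    have := hdsucc k (by omega)
    rwa [hr.zero, add_zero] at this
  · intro c _ _ hc
    exact Nat.dvd_one.1 (hl ▸ hc ℓ le_rfl)
  · intro i hi
    rcases i with _ | i
    · omega
    · exact if_neg (by omega)

lemma zero_le : S.r 0 ≤ ℓ * (S.rx + S.ry) + S.r ℓ :=
  S.isArithPath.zero_le (Nat.add_pos_left S.rx_pos _) S.zero_dvd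

lemma critOrder_mul_le :
    critOrder S * (S.rx * S.ry * S.r ℓ) ≤ ℓ * (S.rx + S.ry) + S.r ℓ :=
  S.critOrder_mul.trans_le S.zero_le

lemma critOrder_le : critOrder S ≤ 2 * ℓ + 1 := by
  have h := S.critOrder_mul_le
  have ha := S.rx_pos
  have hb := S.ry_pos
  have hg := S.r_pos le_rfl
  have hab : S.rx + S.ry ≤ 2 * (S.rx * S.ry) := by nlinarith
  have h1 : ℓ * (S.rx + S.ry) ≤ ℓ * (2 * (S.rx * S.ry * S.r ℓ)) :=
    Nat.mul_le_mul_left _ (hab.trans (Nat.mul_le_mul_left _ (Nat.le_mul_of_pos_right _ hg)))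
  have h2 : S.r ℓ ≤ S.rx * S.ry * S.r ℓ := Nat.le_mul_of_pos_left _ (Nat.mul_pos ha hb)
  exact Nat.le_of_mul_le_mul_right (c := S.rx * S.ry * S.r ℓ) (by nlinarith) (by positivity)

/-- Extremal structures have `r_i = 2 (ℓ - i) + 1` and both prongs labelled `1`. -/
lemma eq_of_critOrder_eq (hℓ : 1 ≤ ℓ) (hS : critOrder S = 2 * ℓ + 1) :
    S.rx = 1 ∧ S.ry = 1 ∧ ∀ i ≤ ℓ, S.r i = 2 * ℓ + 1 - 2 * i := by
  have h := S.critOrder_mul_le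
  have hK := S.critOrder_mul
  rw [hS] at h hK
  have ha := S.rx_pos
  have hb := S.ry_pos
  have hg := S.r_pos le_rfl
  have hP : S.rx * S.ry = 1 := by
    by_contra hne
    have hP : 2 ≤ S.rx * S.ry := by
      have := Nat.mul_pos ha hb
      omega
    have hab : S.rx + S.ry ≤ 1 + S.rx * S.ry := by nlinarith
    have h1 : ℓ * (S.rx + S.ry) ≤ ℓ * (1 + S.rx * S.ry) := Nat.mul_le_mul_left _ hab
    generalize S.rx * S.ry = P at *
    have h2 : 2 * S.r ℓ ≤ P * S.r ℓ := Nat.mul_le_mul_right _ hP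
    have h3 : P * 1 ≤ P * S.r ℓ := Nat.mul_le_mul_left _ hg
    generalize P * S.r ℓ = T at *
    have h4 : ℓ * (1 + P) ≤ ℓ * (2 * T) := Nat.mul_le_mul_left _ (by omega)
    nlinarith
  obtain ⟨hx, hy⟩ := mul_eq_one.1 hP
  have hl : S.r ℓ = 1 := by
    rw [hx, hy] at h
    nlinarith
  refine ⟨hx, hy, fun i hi => ?_⟩
  have h0 : S.r 0 = 2 * ℓ + 1 := by
    rw [← hK, hx, hy, hl]
    ring
  have := S.isArithPath.eq_of_zero_eq (by omega) S.zero_dvd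
    (by rw [h0, hx, hy, hl]; ring) hi
  rw [hx, hy, h0] at this
  omega

lemma exists_critOrder_eq (ℓ : ℕ) : ∃ S : ArithOn (ℓ + 3), critOrder S = 2 * ℓ + 1 := by
  obtain ⟨S, hx, hy, hr⟩ := exists_of_r (ℓ := ℓ) (rx := 1) (ry := 1)
    (r := fun i => 2 * ℓ + 1 - 2 * i)
    ⟨fun i hi => by omega, fun i hi => by
      rcases eq_or_ne (i + 1) ℓ with rfl | h
      · exact ⟨3, by omega⟩
      · exact ⟨2, by omega⟩, by omega⟩ (fun i hi => by omega)
    (one_dvd _) (one_dvd _) (by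
      rcases Nat.eq_zero_or_pos ℓ with rfl | h
      · simp
      · exact ⟨1, by omega⟩) (by omega)
  refine ⟨S, ?_⟩
  have h := S.critOrder_mul
  have hl : S.r ℓ = 1 := (congrFun hr ℓ).trans (by omega)
  have h0 : S.r 0 = 2 * ℓ + 1 := congrFun hr 0
  rw [hx, hy, hl, h0] at h
  omega

lemma exists_critOrder_eq_half {m : ℕ} (hm : Even m) (hm4 : 4 ≤ m) (hm3 : ¬ 3 ∣ m)
    (hℓ : m ≤ 3 * ℓ + 1) : ∃ S : ArithOn (ℓ + 3), critOrder S = m / 2 := by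
  have h3 : m % 3 = 1 ∨ m % 3 = 2 := by omega
  obtain ⟨S, hx, hy, hr⟩ := exists_of_r (ℓ := ℓ) (rx := 1) (ry := 2)
    (r := fun i => if i ≤ ℓ then max 1 (m - 3 * i) else 0)
    ⟨fun i hi => by simp [hi], fun i hi => by
      rw [if_pos (by omega), if_pos (by omega)]
      have : m - 3 * (i + 1) ≤ 1 ∨ m - 3 * (i + 1) = 2 ∨ 4 ≤ m - 3 * (i + 1) := by omega
      rcases this with h | h | h
      · rw [max_eq_left h]
        exact one_dvd _
      · rw [if_pos (by omega)]
        exact ⟨3, by omega⟩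
      · rw [if_pos (by omega)]
        exact ⟨2, by omega⟩, by simp⟩ (fun i hi => if_neg (by omega))
    (one_dvd _) (by
      rw [if_pos (Nat.zero_le _), max_eq_right (by omega)]
      exact hm.two_dvd) (by
      rw [if_pos (by omega), if_pos (by omega)]
      exact ⟨1, by omega⟩) (by
      rw [if_pos le_rfl]
      omega)
  refine ⟨S, ?_⟩
  have h := S.critOrder_mul
  have hl : S.r ℓ = 1 := (congrFun hr ℓ).trans (by rw [if_pos le_rfl]; omega)
  have h0 : S.r 0 = m := (congrFun hr 0).trans (by rw [if_pos (Nat.zero_le _)]; omega)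
  rw [hx, hy, hl, h0] at h
  omega

lemma dvd_last {c : ℕ} (hc : c ∣ S.rx + S.ry) (h0 : c ∣ S.r 0) : c ∣ S.r ℓ :=
  S.isArithPath.dvd_of_dvd_zero_one h0 ((Nat.dvd_add_left hc).1 (h0.trans S.zero_dvd)) le_rfl

/-- Bounds on an even critical group order, according to the prong labels `(1, 1)`, `(1, 2)`
(up to order) or larger. -/
lemma even_critOrder_bound (hS : Even (critOrder S)) :
    critOrder S ≤ ℓ + 1 ∨ (2 * critOrder S ≤ 3 * ℓ + 1 ∧ ¬ 3 ∣ critOrder S) ∨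
      3 * critOrder S ≤ 4 * ℓ + 1 := by
  have h := S.critOrder_mul_le
  have hK := S.critOrder_mul
  have ha := S.rx_pos
  have hb := S.ry_pos
  have hg := S.r_pos le_rfl
  have hcases : S.rx * S.ry = 1 ∨ S.rx * S.ry = 2 ∨ 3 ≤ S.rx * S.ry := by
    have := Nat.mul_pos ha hb
    omega
  rcases hcases with hP | hP | hP
  · left
    obtain ⟨hx, hy⟩ := mul_eq_one.1 hP
    have h2 : 2 ∣ S.r ℓ := S.dvd_last (by simp [hx, hy]) (by
      rw [← hK]
      exact hS.two_dvd.mul_right _)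
    have h2' := Nat.le_of_dvd hg h2
    rw [hx, hy] at h
    nlinarith
  · have hsum : S.rx + S.ry = 3 := by
      have : S.rx ≤ 2 := Nat.le_of_dvd (by omega) (Dvd.intro _ hP)
      interval_cases S.rx <;> omega
    rw [hP, hsum] at h
    by_cases h3 : 3 ∣ critOrder S
    · left
      have h3' := Nat.le_of_dvd hg (S.dvd_last (by rw [hsum]) (by
        rw [← hK]
        exact h3.mul_right _))
      nlinarith
    · refine Or.inr (Or.inl ⟨?_, h3⟩)
      nlinarith
  · right
    right
    have hab : 3 * (S.rx + S.ry) ≤ 4 * (S.rx * S.ry) := by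
      have hcop := S.coprime_rx_ry
      by_cases hx : S.rx = 1
      · rw [hx] at hP ⊢
        omega
      · by_cases hy : S.ry = 1
        · rw [hy] at hP ⊢
          omega
        · by_cases hxy : S.rx = S.ry
          · rw [hxy] at hcop
            exact absurd ((Nat.coprime_self _).1 hcop) hy
          · have : 2 ≤ S.rx := by omega
            have : 2 ≤ S.ry := by omega
            nlinarith
    have h1 : ℓ * (3 * (S.rx + S.ry)) ≤ ℓ * (4 * (S.rx * S.ry)) := Nat.mul_le_mul_left _ hab
    generalize S.rx * S.ry = P at *
    have h3 : 3 * S.r ℓ ≤ P * S.r ℓ := Nat.mul_le_mul_right _ hP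
    have h4 : ℓ * (4 * P) ≤ ℓ * (4 * (P * S.r ℓ)) :=
      Nat.mul_le_mul_left _ (Nat.mul_le_mul_left _ (Nat.le_mul_of_pos_right _ hg))
    exact Nat.le_of_mul_le_mul_right (c := P * S.r ℓ) (by nlinarith) (by positivity)

end ArithOn

/-- **Theorem 5.7.**  Let `n ≥ 4`.
(a) Every arithmetical structure on `D_n` has critical group of order at most `2n - 5`,
and exactly one arithmetical structure on `D_n` has critical group of order `2n - 5`.
(b) For a positive integer `k`, the maximal even order of a critical group of an
arithmetical structure on `D_n` is `6k - 4` if `n = 4k` or `n = 4k + 1`, and `6k - 2` if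
`n = 4k + 2` or `n = 4k + 3`. -/
theorem critGroup_max_order (n : ℕ) (hn : 4 ≤ n) :
    ((∀ S : ArithOn n, critOrder S ≤ 2 * n - 5) ∧
      (∃! S : ArithOn n, critOrder S = 2 * n - 5)) ∧
    (∀ k : ℕ, 0 < k →
      ((n = 4 * k ∨ n = 4 * k + 1) →
        IsGreatest {m : ℕ | Even m ∧ ∃ S : ArithOn n, critOrder S = m} (6 * k - 4)) ∧
      ((n = 4 * k + 2 ∨ n = 4 * k + 3) →
        IsGreatest {m : ℕ | Even m ∧ ∃ S : ArithOn n, critOrder S = m} (6 * k - 2))) := by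
  obtain ⟨ℓ, rfl⟩ := Nat.exists_eq_add_of_le' (show 3 ≤ n by omega)
  have hℓ : 2 * (ℓ + 3) - 5 = 2 * ℓ + 1 := by omega
  rw [hℓ]
  refine ⟨⟨fun S => S.critOrder_le, ?_⟩, fun k hk => ⟨fun hnk => ⟨?_, ?_⟩, fun hnk => ⟨?_, ?_⟩⟩⟩
  · obtain ⟨S, hS⟩ := ArithOn.exists_critOrder_eq ℓ
    refine ⟨S, hS, fun T hT => ?_⟩
    obtain ⟨hSx, hSy, hSr⟩ := S.eq_of_critOrder_eq (by omega) hS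
    obtain ⟨hTx, hTy, hTr⟩ := T.eq_of_critOrder_eq (by omega) hT
    exact ArithOn.ext_of_r (hTx.trans hSx.symm) (hTy.trans hSy.symm)
      fun i hi => (hTr i hi).trans (hSr i hi).symm
  · obtain ⟨S, hS⟩ := ArithOn.exists_critOrder_eq_half (ℓ := ℓ) (m := 12 * k - 8)
      ⟨6 * k - 4, by omega⟩ (by omega) (by omega) (by omega)
    exact ⟨⟨3 * k - 2, by omega⟩, S, hS.trans (by omega)⟩
  · rintro _ ⟨hm, S, rfl⟩
    have := S.even_critOrder_bound hm
    obtain ⟨j, hj⟩ := hm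
    omega
  · obtain ⟨S, hS⟩ := ArithOn.exists_critOrder_eq_half (ℓ := ℓ) (m := 12 * k - 4)
      ⟨6 * k - 2, by omega⟩ (by omega) (by omega) (by omega)
    exact ⟨⟨3 * k - 1, by omega⟩, S, hS.trans (by omega)⟩
  · rintro _ ⟨hm, S, rfl⟩
    have hne : critOrder S = 6 * k → 3 ∣ critOrder S := fun h => h ▸ ⟨2 * k, by ring⟩
    have := S.even_critOrder_bound hm
    obtain ⟨j, hj⟩ := hm
    omega
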